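/- Let 𝒯 be a balanced staged tree and let A_𝒯 be the ℝ-subalgebra of the polynomial ring ℝ[Θ,z] generated by the monomials z^{d−d(λ_r)}·∏_{e∈E(λ_r)} θ(e) for r = 1,…,n, associated to the root-to-leaf paths of 𝒯. Then A_𝒯 is a normal ring (integrally closed in its field of fractions). Equivalently, the multiplicative semigroup M of monomials generated by these path monomials is normal: whenever a, b, c ∈ M satisfy a·b^N = c^N for some positive integer N, there exists e ∈ M with a = e^N. -/

import Mathlib

noncomputable section
open scoped Classical
open MvPolynomial

/-- A staged tree: a finite rooted tree with edges directed away from the root,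
each non-root vertex `c` carrying the label `label c` of the edge from `parent c` to `c`;
labels of outgoing edges of a vertex are pairwise distinct, and the outgoing label sets
of two vertices are either equal (same stage) or disjoint. -/
structure StagedTree (Θ : Type) [DecidableEq Θ] : Type 1 where
  V : Type
  fintypeV : Fintype V
  decEqV : DecidableEq V
  root : V
  parent : V → V
  label : V → Θ
  parent_root : parent root = root
  reaches_root : ∀ v : V, ∃ n : ℕ, parent^[n] v = root
  label_inj : ∀ u v : V, u ≠ root → v ≠ root → parent u = parent v → label u = label v → u = v
  stage_disjoint : ∀ u v : V,
    (∀ θ : Θ, (∃ c, c ≠ root ∧ parent c = u ∧ label c = θ) ↔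
        (∃ c, c ≠ root ∧ parent c = v ∧ label c = θ)) ∨
    (∀ θ : Θ, ¬((∃ c, c ≠ root ∧ parent c = u ∧ label c = θ) ∧
        (∃ c, c ≠ root ∧ parent c = v ∧ label c = θ)))

namespace StagedTree

attribute [instance] StagedTree.fintypeV StagedTree.decEqV

variable {Θ : Type} [DecidableEq Θ] (T : StagedTree Θ)

/-- `c` is a child of `v`. -/
def IsChild (v c : T.V) : Prop := c ≠ T.root ∧ T.parent c = v

/-- `v` is a leaf (no children). -/
def IsLeaf (v : T.V) : Prop := ∀ c, ¬ T.IsChild v c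

/-- `w` lies in the subtree rooted at `v` (i.e. `v` is an ancestor of `w` or `w` itself). -/
def Desc (v w : T.V) : Prop := ∃ n : ℕ, T.parent^[n] w = v

/-- Distance of `v` from the root. -/
def depthOf (v : T.V) : ℕ := Nat.find (T.reaches_root v)

/-- The depth `d` of the tree: maximal number of edges on a root-to-leaf path. -/
def depth : ℕ := Finset.univ.sup T.depthOf

/-- The type of leaves of `T`. -/
def Leaf : Type := {v : T.V // T.IsLeaf v}

instance : Fintype T.Leaf := Subtype.fintype _

/-- Product of the labels along the root-to-`v` path, in `ℝ[Θ]`. -/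
def pathProd (v : T.V) : MvPolynomial Θ ℝ :=
  ∏ i ∈ Finset.range (T.depthOf v), X (T.label (T.parent^[i] v))

/-- Homogenised root-to-`v` path monomial `z^(d - d(λ)) ∏ θ(e)` in `ℝ[Θ, z]`,
where the variable `none` plays the role of `z`. -/
def hpm (v : T.V) : MvPolynomial (Option Θ) ℝ :=
  (X none) ^ (T.depth - T.depthOf v) *
    ∏ i ∈ Finset.range (T.depthOf v), X (some (T.label (T.parent^[i] v)))

/-- The ideal `⟨θ - z⟩` of homogenised local sum-to-one conditions. -/
def sumIdeal : Ideal (MvPolynomial (Option Θ) ℝ) :=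
  Ideal.span {f | ∃ v : T.V, ¬ T.IsLeaf v ∧
    f = (∑ c ∈ Finset.univ.filter (fun c => T.IsChild v c), X (some (T.label c))) - X none}

/-- The homogenised parametrisation `φ_T : ℝ[p] → ℝ[Θ, z]/⟨θ - z⟩`. -/
def phi : MvPolynomial T.Leaf ℝ →ₐ[ℝ] MvPolynomial (Option Θ) ℝ ⧸ T.sumIdeal :=
  aeval (fun l : T.Leaf => Ideal.Quotient.mk T.sumIdeal (T.hpm l.1))

/-- The ideal `⟨θ - 1⟩` of local sum-to-one conditions. -/
def oneIdeal : Ideal (MvPolynomial Θ ℝ) :=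
  Ideal.span {f | ∃ v : T.V, ¬ T.IsLeaf v ∧
    f = (∑ c ∈ Finset.univ.filter (fun c => T.IsChild v c), X (T.label c)) - 1}

/-- The (non-homogenised) parametrisation `φ_T : ℝ[p] → ℝ[Θ]/⟨θ - 1⟩`. -/
def phi1 : MvPolynomial T.Leaf ℝ →ₐ[ℝ] MvPolynomial Θ ℝ ⧸ T.oneIdeal :=
  aeval (fun l : T.Leaf => Ideal.Quotient.mk T.oneIdeal (T.pathProd l.1))

/-- The subtree polynomial `t(v)`: sum over all `v`-to-leaf paths of the products of
edge labels along the path. -/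
def tpoly (v : T.V) : MvPolynomial Θ ℝ :=
  ∑ l ∈ Finset.univ.filter (fun w => T.IsLeaf w ∧ T.Desc v w),
    ∏ i ∈ Finset.range (T.depthOf l - T.depthOf v), X (T.label (T.parent^[i] l))

/-- Two non-leaf vertices are in the same stage when their outgoing label sets coincide. -/
def SameStage (u v : T.V) : Prop :=
  ¬ T.IsLeaf u ∧ ¬ T.IsLeaf v ∧
    ∀ θ : Θ, (∃ c, T.IsChild u c ∧ T.label c = θ) ↔ (∃ c, T.IsChild v c ∧ T.label c = θ)

/-- `T` is balanced: `t(u_i)·t(v_j) = t(u_j)·t(v_i)` for all `u ∼ v` and all pairs of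
children matched via the common labels. -/
def Balanced : Prop :=
  ∀ u v ui uj vi vj : T.V, T.SameStage u v →
    T.IsChild u ui → T.IsChild u uj → T.IsChild v vi → T.IsChild v vj →
    T.label ui = T.label vi → T.label uj = T.label vj →
    T.tpoly ui * T.tpoly vj = T.tpoly uj * T.tpoly vi

/-- `p_{[v]}`: sum of the variables `p_r` over root-to-leaf paths through `v`. -/
def pSum (v : T.V) : MvPolynomial T.Leaf ℝ :=
  ∑ l ∈ Finset.univ.filter (fun l : T.Leaf => T.Desc v l.1), X l

/-- `T` has toric structure: there are linearly independent linear forms in which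
`ker φ_T` is generated by binomials. -/
def Toric : Prop :=
  ∃ L : T.Leaf → MvPolynomial T.Leaf ℝ,
    (∀ i, (L i).IsHomogeneous 1) ∧ LinearIndependent ℝ L ∧
    ∃ B : Set (MvPolynomial T.Leaf ℝ),
      (∀ f ∈ B, ∃ a b : T.Leaf → ℕ, f = (∏ i, L i ^ a i) - (∏ i, L i ^ b i)) ∧
      RingHom.ker T.phi.toRingHom = Ideal.span B

end StagedTree

namespace StagedTree

variable {Θ : Type} [DecidableEq Θ] (T : StagedTree Θ)

open MvPolynomial

/-- The exponent vector of the homogenised root-to-`v` path monomial. -/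
def hpmExp (v : T.V) : Option Θ →₀ ℕ :=
  Finsupp.single none (T.depth - T.depthOf v) +
    ∑ i ∈ Finset.range (T.depthOf v), Finsupp.single (some (T.label (T.parent^[i] v))) 1

/-- The semigroup (additively: the monoid of exponent vectors) generated by the
homogenised path monomials of `T`. -/
def pathMonoid : AddSubmonoid (Option Θ →₀ ℕ) :=
  AddSubmonoid.closure (Set.range fun l : T.Leaf => T.hpmExp l.1)

/-- The monomial algebra `A_𝒯 ⊆ ℝ[Θ,z]` generated by the homogenised path monomials. -/
def pathAlgebra : Subalgebra ℝ (MvPolynomial (Option Θ) ℝ) :=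
  Algebra.adjoin ℝ (Set.range fun l : T.Leaf => T.hpm l.1)

end StagedTree

namespace MvPolynomial

section
variable {σ k : Type*} [Field k]

/-- The `k`-algebra map `k[σ] → k[σ][σ]` sending each variable `X i` to `X i ⊗ X i`. -/
noncomputable def gradingHom : MvPolynomial σ k →ₐ[k] MvPolynomial σ (MvPolynomial σ k) :=
  aeval fun i => C (X i) * X i

lemma gradingHom_monomial (m : σ →₀ ℕ) (a : k) :
    gradingHom (monomial m a) = monomial m (monomial m a) := by
  rw [gradingHom, aeval_monomial]
  simp only [mul_pow, Finsupp.prod_mul]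
  rw [monomial_eq (s := m) (a := monomial m a), monomial_eq (s := m) (a := a)]
  simp only [map_mul, Finsupp.prod, map_prod, map_pow]
  rw [mul_assoc]
  rfl

lemma coeff_gradingHom (m : σ →₀ ℕ) (f : MvPolynomial σ k) :
    (gradingHom f).coeff m = monomial m (f.coeff m) := by
  induction f using MvPolynomial.induction_on' with
  | monomial u a =>
    rw [gradingHom_monomial, coeff_monomial, coeff_monomial]
    split_ifs with h
    · rw [h]
    · simp
  | add p q hp hq => simp [hp, hq]

variable {A : Subalgebra k (MvPolynomial σ k)} {M : AddSubmonoid (σ →₀ ℕ)}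

/-- If `h` is integral over a monomial subalgebra, so are its terms. -/
lemma isIntegral_monomial_coeff (hA : ∀ f, f ∈ A ↔ ∀ m ∈ f.support, m ∈ M)
    {h : MvPolynomial σ k} (h_int : IsIntegral A h) (m : σ →₀ ℕ) :
    IsIntegral A (monomial m (h.coeff m)) := by
  let j : MvPolynomial σ A →+* MvPolynomial σ (MvPolynomial σ k) := map A.val.toRingHom
  have hj : Function.Injective j := map_injective _ Subtype.val_injective
  have hmem (a : A) : gradingHom a.1 ∈ RingHom.range (R := MvPolynomial σ A) j := by
    refine mem_range_map_iff_coeffs_subset.2 ?_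
    intro c hc
    obtain ⟨n, hn, rfl⟩ := mem_coeffs_iff.1 hc
    rw [mem_support_iff, coeff_gradingHom] at hn
    rw [coeff_gradingHom]
    refine ⟨⟨_, (hA _).2 fun u hu => ?_⟩, rfl⟩
    obtain rfl := Finset.mem_singleton.1 (support_monomial_subset hu)
    exact (hA _).1 a.2 _ (mem_support_iff.2 fun h0 => hn (by rw [h0, map_zero]))
  let E := RingEquiv.ofBijective j.rangeRestrict
    ⟨fun a b hab => hj (congrArg Subtype.val hab), j.rangeRestrict_surjective⟩
  let φ : A →+* MvPolynomial σ A := E.symm.toRingHom.comp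
      ((gradingHom.toRingHom.comp A.val.toRingHom).codRestrict _ hmem)
  let _ := algebraMvPolynomial (σ := σ) (R := A) (S := MvPolynomial σ k)
  have key : IsIntegral (MvPolynomial σ A) (gradingHom h) := by
    refine h_int.map_of_comp_eq φ gradingHom.toRingHom ?_
    ext1 a
    have := E.apply_symm_apply ⟨gradingHom a.1, hmem a⟩
    exact congrArg Subtype.val this
  rw [← coeff_gradingHom]
  exact isIntegral_iff_isIntegral_coeff.1 key m

/-- If a nonzero term is integral over a monomial subalgebra, then a positive multiple of its
exponent is an exponent of the subalgebra. -/
lemma exists_nsmul_mem_of_isIntegral_monomial (hA : ∀ f, f ∈ A ↔ ∀ m ∈ f.support, m ∈ M)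
    {m : σ →₀ ℕ} {a : k} (ha : a ≠ 0) (h_int : IsIntegral A (monomial m a)) :
    ∃ N, 0 < N ∧ N • m ∈ M := by
  obtain ⟨p, hp, hp0⟩ := h_int
  by_contra! hcon
  have hc := congrArg (coeff (p.natDegree • m)) hp0
  rw [Polynomial.eval₂_eq_sum_range, Finset.sum_range_succ, coeff_add, coeff_sum,
    Finset.sum_eq_zero, hp.coeff_natDegree, map_one, one_mul, monomial_pow, coeff_monomial,
    if_pos rfl, zero_add, coeff_zero] at hc
  · exact pow_ne_zero _ ha hc
  · intro i hi
    have hi := Finset.mem_range.1 hi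
    rw [monomial_pow, coeff_mul_monomial']
    split_ifs with hle
    · have : p.natDegree • m - i • m = (p.natDegree - i) • m := by
        ext; simp [Nat.sub_mul]
      rw [this]
      have hz := mt ((hA _).1 (p.coeff i).2 _) (hcon (p.natDegree - i) (by omega))
      rw [mem_support_iff, not_not] at hz
      exact mul_eq_zero_of_left hz _
    · rfl

/-- A polynomial that becomes an element of a monomial subalgebra after multiplication by a nonzero
element of it has its exponents among the differences of exponents of the subalgebra. -/
lemma exists_add_mem_of_mul_mem (hA : ∀ f, f ∈ A ↔ ∀ m ∈ f.support, m ∈ M)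
    {h q : MvPolynomial σ k} (hq : q ∈ A) (hq0 : q ≠ 0) (hmul : h * q ∈ A)
    {m : σ →₀ ℕ} (hm : m ∈ h.support) : ∃ b ∈ M, m + b ∈ M := by
  by_contra! hcon
  let P : (σ →₀ ℕ) → Prop := fun u => ∃ b ∈ M, u + b ∈ M
  let h₁ : MvPolynomial σ k := ∑ u ∈ h.support with P u, monomial u (h.coeff u)
  let h₂ : MvPolynomial σ k := ∑ u ∈ h.support with ¬ P u, monomial u (h.coeff u)
  have hsum : h₁ + h₂ = h := by
    rw [Finset.sum_filter_add_sum_filter_not]; exact support_sum_monomial_coeff h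
  have hs₁ (u) (hu : u ∈ h₁.support) : P u := by
    obtain ⟨v, hv, huv⟩ := Finset.mem_biUnion.1 (support_sum hu)
    obtain rfl := Finset.mem_singleton.1 (support_monomial_subset huv)
    exact (Finset.mem_filter.1 hv).2
  have hs₂ (u) (hu : u ∈ h₂.support) : ¬ P u := by
    obtain ⟨v, hv, huv⟩ := Finset.mem_biUnion.1 (support_sum hu)
    obtain rfl := Finset.mem_singleton.1 (support_monomial_subset huv)
    exact (Finset.mem_filter.1 hv).2
  have hmul₁ (u) (hu : u ∈ (h₁ * q).support) : P u := by
    obtain ⟨v, hv, w, hw, rfl⟩ := Finset.mem_add.1 (support_mul _ _ hu)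
    obtain ⟨b, hb, hvb⟩ := hs₁ v hv
    refine ⟨b, hb, ?_⟩
    rw [add_right_comm]
    exact M.add_mem hvb ((hA _).1 hq _ hw)
  have hmul₂ (u) (hu : u ∈ (h₂ * q).support) : ¬ P u := by
    obtain ⟨v, hv, w, hw, rfl⟩ := Finset.mem_add.1 (support_mul _ _ hu)
    rintro ⟨b, hb, hvb⟩
    refine hs₂ v hv ⟨w + b, M.add_mem ((hA _).1 hq _ hw) hb, ?_⟩
    rwa [← add_assoc]
  have hzero : h₂ * q = 0 := by
    rw [← support_eq_empty, Finset.eq_empty_iff_forall_notMem]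
    intro u hu
    have h1 : (h₁ * q).coeff u = 0 := by
      rw [← notMem_support_iff]; exact fun h' => hmul₂ u hu (hmul₁ u h')
    refine hmul₂ u hu ⟨0, M.zero_mem, ?_⟩
    rw [add_zero]
    refine (hA _).1 hmul u ?_
    rw [mem_support_iff] at hu ⊢
    rwa [← hsum, add_mul, coeff_add, h1, zero_add]
  have h₂0 : h₂ = 0 := (mul_eq_zero.1 hzero).resolve_right hq0
  rw [← hsum, h₂0, add_zero] at hm
  obtain ⟨b, hb, hmb⟩ := hs₁ m hm
  exact hcon b hb hmb

/-- A monomial algebra over a field is integrally closed if its exponent monoid is normal. -/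
theorem isIntegrallyClosed_of_normal (hA : ∀ f, f ∈ A ↔ ∀ m ∈ f.support, m ∈ M)
    (hM : ∀ m b : σ →₀ ℕ, b ∈ M → m + b ∈ M → ∀ N, 0 < N → N • m ∈ M → m ∈ M) :
    IsIntegrallyClosed A := by
  rw [isIntegrallyClosed_iff (FractionRing A)]
  intro x hx
  obtain ⟨p, q, hq, rfl⟩ := IsFractionRing.div_surjective (A := A) x
  have hq0 : q ≠ 0 := nonZeroDivisors.ne_zero hq
  let S := MvPolynomial σ k
  let L := FractionRing S
  let g : A →+* L := (algebraMap S L).comp A.val.toRingHom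
  have hg : Function.Injective g :=
    (IsFractionRing.injective S L).comp Subtype.val_injective
  have hlift (a : A) : IsFractionRing.lift (K := FractionRing A) hg
      (algebraMap A (FractionRing A) a) = algebraMap S L a.1 :=
    IsFractionRing.lift_algebraMap hg a
  set y : L := IsFractionRing.lift (K := FractionRing A) hg
    (algebraMap A (FractionRing A) p / algebraMap A (FractionRing A) q) with hy
  have hyA : IsIntegral A y := by
    have := hx.map_of_comp_eq (RingHom.id A) (IsFractionRing.lift (K := FractionRing A) hg)
    refine this ?_
    ext1 a
    exact (hlift a).symm
  have hyS : IsIntegral S y := hyA.tower_top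
  obtain ⟨h, hh⟩ := IsIntegrallyClosed.isIntegral_iff.1 hyS
  have hq0' : q.1 ≠ 0 := fun h0 => hq0 (Subtype.ext h0)
  have hhq : h * q.1 = p.1 := by
    apply IsFractionRing.injective S L
    rw [map_mul, hh, hy, map_div₀, hlift, hlift, div_mul_cancel₀]
    exact (map_ne_zero_iff _ (IsFractionRing.injective S L)).2 hq0'
  have hhA : IsIntegral A h := by
    rw [← hh] at hyA
    exact (isIntegral_algebraMap_iff (IsFractionRing.injective S L)).1 hyA
  have hmem : h ∈ A := by
    refine (hA h).2 fun m hm => ?_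
    obtain ⟨b, hb, hmb⟩ := exists_add_mem_of_mul_mem hA q.2 hq0' (hhq ▸ p.2) hm
    obtain ⟨N, hN, hNm⟩ := exists_nsmul_mem_of_isIntegral_monomial hA (mem_support_iff.1 hm)
      (isIntegral_monomial_coeff hA hhA m)
    exact hM m b hb hmb N hN hNm
  refine ⟨⟨h, hmem⟩, ?_⟩
  rw [eq_div_iff ((map_ne_zero_iff _ (IsFractionRing.injective A _)).2 hq0), ← map_mul]
  exact congrArg _ (Subtype.ext hhq)

/-- The algebra generated by a family of monomials consists of the polynomials whose exponents lie
in the monoid generated by the exponents of the family. -/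
lemma mem_adjoin_monomial_iff {ι : Type*} (e : ι → σ →₀ ℕ) (f : MvPolynomial σ k) :
    f ∈ Algebra.adjoin k (Set.range fun i => monomial (e i) (1 : k)) ↔
      ∀ m ∈ f.support, m ∈ AddSubmonoid.closure (Set.range e) := by
  constructor
  · intro hf
    induction hf using Algebra.adjoin_induction with
    | mem x hx =>
      obtain ⟨i, rfl⟩ := hx
      intro m hm
      obtain rfl := Finset.mem_singleton.1 (support_monomial_subset hm)
      exact AddSubmonoid.subset_closure ⟨i, rfl⟩
    | algebraMap r =>
      intro m hm
      obtain rfl := Finset.mem_singleton.1 (support_monomial_subset hm)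
      exact zero_mem _
    | add x y _ _ hx hy =>
      intro m hm
      exact (Finset.mem_union.1 (support_add hm)).elim (hx m) (hy m)
    | mul x y _ _ hx hy =>
      intro m hm
      obtain ⟨v, hv, w, hw, rfl⟩ := Finset.mem_add.1 (support_mul _ _ hm)
      exact add_mem (hx v hv) (hy w hw)
  · intro hf
    have hmon (m) (hm : m ∈ AddSubmonoid.closure (Set.range e)) :
        monomial m (1 : k) ∈ Algebra.adjoin k (Set.range fun i => monomial (e i) (1 : k)) := by
      induction hm using AddSubmonoid.closure_induction with
      | mem x hx =>
        obtain ⟨i, rfl⟩ := hx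
        exact Algebra.subset_adjoin ⟨i, rfl⟩
      | zero => exact one_mem _
      | add x y _ _ hx hy =>
        have := mul_mem hx hy
        rwa [monomial_mul, one_mul] at this
    rw [← support_sum_monomial_coeff f]
    refine sum_mem fun m hm => ?_
    rw [← mul_one (f.coeff m), ← smul_eq_mul, ← smul_monomial]
    exact Subalgebra.smul_mem _ (hmon m (hf m hm)) _

end
end MvPolynomial

namespace StagedTree

variable {Θ : Type} [DecidableEq Θ] (T : StagedTree Θ)

/-- If a nonnegative array with integral column sums has its support arranged in a staircase, then
its entry `e` is integral as soon as the row sums up to the row of `e` are integral. -/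
lemma mem_int_range_of_staircase {ι : Type*} (E : Finset ι) (r s : ι → ℕ) (h : ι → ℝ)
    (hnonneg : ∀ c ∈ E, 0 ≤ h c)
    (hinj : ∀ c ∈ E, ∀ c' ∈ E, r c = r c' → s c = s c' → c = c')
    (hstair : ∀ c ∈ E, ∀ c' ∈ E, 0 < h c → 0 < h c' → r c < r c' → s c ≤ s c')
    (hcol : ∀ b, ∑ c ∈ E with s c = b, h c ∈ (Int.castAddHom ℝ).range)
    {e : ι} (he : e ∈ E)
    (hrow : ∀ a ≤ r e, ∑ c ∈ E with r c = a, h c ∈ (Int.castAddHom ℝ).range) :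
    h e ∈ (Int.castAddHom ℝ).range := by
  have hpartial (t : ι → ℕ) (a : ℕ)
      (ht : ∀ a' < a, ∑ c ∈ E with t c = a', h c ∈ (Int.castAddHom ℝ).range) :
      ∑ c ∈ E with t c < a, h c ∈ (Int.castAddHom ℝ).range := by
    have hmaps : ∀ c ∈ E.filter (fun c => t c < a), t c ∈ Finset.range a := fun c hc =>
      Finset.mem_range.2 (Finset.mem_filter.1 hc).2
    rw [← Finset.sum_fiberwise_of_maps_to hmaps]
    refine sum_mem fun a' ha' => ?_
    have ha' := Finset.mem_range.1 ha'
    have hcongr : E.filter (fun c => t c < a ∧ t c = a') = E.filter fun c => t c = a' :=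
      Finset.filter_congr fun c _ => ⟨And.right, fun hc => ⟨hc.trans_lt ha', hc⟩⟩
    rw [Finset.filter_filter, hcongr]
    exact ht a' ha'
  have hF (a b : ℕ) (ha : a ≤ r e + 1) :
      ∑ c ∈ E with r c < a ∧ s c < b, h c ∈ (Int.castAddHom ℝ).range := by
    by_cases hz : ∀ c ∈ E, r c < a → b ≤ s c → h c = 0
    · have : ∑ c ∈ E with r c < a ∧ s c < b, h c = ∑ c ∈ E with r c < a, h c := by
        rw [← Finset.filter_filter]
        refine Finset.sum_filter_of_ne fun c hc hne => ?_
        by_contra hlt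
        obtain ⟨hcE, hca⟩ := Finset.mem_filter.1 hc
        exact hne (hz c hcE hca (not_lt.1 hlt))
      rw [this]
      exact hpartial r a fun a' ha' => hrow a' (by omega)
    · push Not at hz
      obtain ⟨c, hcE, hca, hbc, hc0⟩ := hz
      have hcpos := lt_of_le_of_ne (hnonneg c hcE) hc0.symm
      have : ∑ c ∈ E with r c < a ∧ s c < b, h c = ∑ c ∈ E with s c < b, h c := by
        have hcomm : E.filter (fun c => r c < a ∧ s c < b) =
            (E.filter fun c => s c < b).filter fun c => r c < a := by
          rw [Finset.filter_filter]
          exact Finset.filter_congr fun c _ => and_comm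
        rw [hcomm]
        refine Finset.sum_filter_of_ne fun c' hc' hne => ?_
        by_contra hlt
        obtain ⟨hcE', hcb'⟩ := Finset.mem_filter.1 hc'
        have := hstair c hcE c' hcE' hcpos (lt_of_le_of_ne (hnonneg c' hcE') hne.symm) (by omega)
        omega
      rw [this]
      exact hpartial s b fun b' _ => hcol b'
  have hincl : h e = (∑ c ∈ E with r c < r e + 1 ∧ s c < s e + 1, h c
      - ∑ c ∈ E with r c < r e ∧ s c < s e + 1, h c)
      - (∑ c ∈ E with r c < r e + 1 ∧ s c < s e, h c
      - ∑ c ∈ E with r c < r e ∧ s c < s e, h c) := by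
    have hsingle : h e = ∑ c ∈ E, if c = e then h c else 0 := by
      rw [Finset.sum_ite_eq' E e h, if_pos he]
    rw [hsingle]
    simp only [Finset.sum_filter, ← Finset.sum_sub_distrib]
    refine Finset.sum_congr rfl fun c hc => ?_
    by_cases hce : c = e
    · subst hce; simp
    · have : ¬ (r c = r e ∧ s c = s e) := fun hrs => hce (hinj c hc e he hrs.1 hrs.2)
      rw [if_neg hce]
      split_ifs <;> first | omega | simp
  rw [hincl]
  exact sub_mem (sub_mem (hF _ _ le_rfl) (hF _ _ (Nat.le_succ _)))
    (sub_mem (hF _ _ le_rfl) (hF _ _ (Nat.le_succ _)))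

section Paths

variable {T}

lemma parent_iterate_depthOf (v : T.V) : T.parent^[T.depthOf v] v = T.root :=
  Nat.find_spec (T.reaches_root v)

lemma parent_iterate_ne_root {v : T.V} {i : ℕ} (hi : i < T.depthOf v) :
    T.parent^[i] v ≠ T.root :=
  Nat.find_min (T.reaches_root v) hi

lemma depthOf_root : T.depthOf T.root = 0 :=
  (Nat.find_eq_zero _).2 rfl

lemma depthOf_eq_succ {v : T.V} (hv : v ≠ T.root) :
    T.depthOf v = T.depthOf (T.parent v) + 1 :=
  Nat.find_comp_succ (T.reaches_root v) (T.reaches_root (T.parent v)) hv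

lemma depthOf_iterate (v : T.V) {i : ℕ} (hi : i ≤ T.depthOf v) :
    T.depthOf (T.parent^[i] v) + i = T.depthOf v := by
  induction i with
  | zero => rfl
  | succ i ih =>
    rw [← ih (by omega), depthOf_eq_succ (parent_iterate_ne_root (i := i) (by omega)),
      Function.iterate_succ_apply']
    omega

lemma depthOf_le_depth (v : T.V) : T.depthOf v ≤ T.depth :=
  Finset.le_sup (f := T.depthOf) (Finset.mem_univ v)

lemma desc_iff {v w : T.V} :
    T.Desc v w ↔ T.depthOf v ≤ T.depthOf w ∧ T.parent^[T.depthOf w - T.depthOf v] w = v := by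
  refine ⟨?_, fun h => ⟨_, h.2⟩⟩
  rintro ⟨n, rfl⟩
  rcases le_or_gt n (T.depthOf w) with hn | hn
  · have := depthOf_iterate w hn
    refine ⟨by omega, ?_⟩
    congr 1
    omega
  · have : T.parent^[n] w = T.root := by
      obtain ⟨k, rfl⟩ := Nat.exists_eq_add_of_lt hn
      rw [add_assoc, add_comm, Function.iterate_add_apply, parent_iterate_depthOf]
      exact Function.iterate_fixed T.parent_root _
    rw [this, depthOf_root]
    exact ⟨Nat.zero_le _, parent_iterate_depthOf w⟩

lemma desc_root (v : T.V) : T.Desc T.root v := T.reaches_root v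

lemma Desc.exists_child {v w : T.V} (h : T.Desc v w) (hne : v ≠ w) :
    ∃ c, T.IsChild v c ∧ T.Desc c w := by
  obtain ⟨hle, hw⟩ := desc_iff.1 h
  obtain ⟨n, hn⟩ : ∃ n, T.depthOf w - T.depthOf v = n + 1 := by
    refine Nat.exists_eq_add_one_of_ne_zero fun h0 => hne ?_
    rw [← hw, h0]
    rfl
  refine ⟨T.parent^[n] w, ⟨parent_iterate_ne_root (by omega), ?_⟩, n, rfl⟩
  rw [hn] at hw
  exact (Function.iterate_succ_apply' T.parent n w).symm.trans hw

lemma IsChild.depthOf_eq {v c : T.V} (h : T.IsChild v c) : T.depthOf c = T.depthOf v + 1 := by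
  rw [depthOf_eq_succ h.1, h.2]

lemma IsChild.desc {v c w : T.V} (h : T.IsChild v c) (hw : T.Desc c w) : T.Desc v w := by
  obtain ⟨n, hn⟩ := hw
  exact ⟨n + 1, by rw [Function.iterate_succ_apply', hn, h.2]⟩

lemma IsChild.eq_of_desc {v c c' w : T.V} (h : T.IsChild v c) (h' : T.IsChild v c')
    (hw : T.Desc c w) (hw' : T.Desc c' w) : c = c' := by
  rw [← (desc_iff.1 hw).2, ← (desc_iff.1 hw').2, h.depthOf_eq, h'.depthOf_eq]

lemma Desc.eq_of_isLeaf {v w : T.V} (h : T.Desc v w) (hv : T.IsLeaf v) : v = w := by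
  by_contra hne
  obtain ⟨c, hc, -⟩ := h.exists_child hne
  exact hv c hc

lemma sum_isChild_ite_desc {u : T.V} (hu : ¬ T.IsLeaf u) (l : T.Leaf) (x : ℝ) :
    ∑ c with T.IsChild u c, (if T.Desc c l.1 then x else 0) = if T.Desc u l.1 then x else 0 := by
  by_cases h : T.Desc u l.1
  · obtain ⟨c, hc, hcl⟩ := h.exists_child fun he => hu (he ▸ l.2)
    rw [if_pos h, Finset.sum_eq_single_of_mem c (by simpa using hc), if_pos hcl]
    intro c' hc' hne
    exact if_neg fun hcl' => hne (IsChild.eq_of_desc (by simpa using hc') hc hcl' hcl)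
  · rw [if_neg h]
    refine Finset.sum_eq_zero fun c hc => if_neg fun hcl => h (IsChild.desc ?_ hcl)
    simpa using hc

variable {A : Type*} [AddCommMonoid A]

variable (T) in
/-- The sum of `φ` over the edges of the path from `v` down to `w`, an edge being represented by its
lower end. -/
def segSum (φ : T.V → A) (v w : T.V) : A :=
  ∑ i ∈ Finset.range (T.depthOf w - T.depthOf v), φ (T.parent^[i] w)

variable (T) in
/-- The sum of `φ` over the edges of the path from the root to `w`. -/
def pathSum (φ : T.V → A) (w : T.V) : A :=
  ∑ i ∈ Finset.range (T.depthOf w), φ (T.parent^[i] w)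

lemma pathSum_eq_segSum_add (φ : T.V → A) {v w : T.V} (h : T.Desc v w) :
    T.pathSum φ w = T.segSum φ v w + T.pathSum φ v := by
  obtain ⟨hle, hw⟩ := desc_iff.1 h
  obtain ⟨n, hn⟩ := Nat.exists_eq_add_of_le' hle
  rw [pathSum, segSum, pathSum, hn, Finset.sum_range_add, Nat.add_sub_cancel]
  rw [hn, Nat.add_sub_cancel] at hw
  congr 1
  refine Finset.sum_congr rfl fun i _ => ?_
  rw [add_comm, Function.iterate_add_apply, hw]

lemma IsChild.pathSum_eq (φ : T.V → A) {v c : T.V} (h : T.IsChild v c) :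
    T.pathSum φ c = φ c + T.pathSum φ v := by
  rw [pathSum, h.depthOf_eq, Finset.sum_range_succ', add_comm, pathSum]
  simp only [Function.iterate_succ_apply, h.2, Function.iterate_zero_apply]

lemma pathSum_eq_sum_desc (φ : T.V → A) (w : T.V) :
    T.pathSum φ w = ∑ v with v ≠ T.root ∧ T.Desc v w, φ v := by
  refine Finset.sum_bij (fun i _ => T.parent^[i] w) ?_ ?_ ?_ ?_
  · intro i hi
    simpa using ⟨parent_iterate_ne_root (Finset.mem_range.1 hi), i, rfl⟩
  · intro i hi j hj hij
    have h1 := depthOf_iterate w (Finset.mem_range.1 hi).le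
    have h2 := depthOf_iterate w (Finset.mem_range.1 hj).le
    rw [hij] at h1
    omega
  · intro v hv
    obtain ⟨hv0, hvw⟩ := (Finset.mem_filter.1 hv).2
    obtain ⟨hle, hw⟩ := desc_iff.1 hvw
    refine ⟨_, Finset.mem_range.2 (Nat.sub_lt_self ?_ hle), hw⟩
    rw [depthOf_eq_succ hv0]
    omega
  · intros; rfl

end Paths

section Exchange

variable {T}

lemma tpoly_eq (v : T.V) :
    T.tpoly v = ∑ l with T.IsLeaf l ∧ T.Desc v l,
      monomial (T.segSum (fun c => Finsupp.single (T.label c) 1) v l) (1 : ℝ) := by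
  refine Finset.sum_congr rfl fun l _ => ?_
  rw [segSum, monomial_sum_one]
  rfl

lemma coeff_tpoly_nonneg (v : T.V) (m : Θ →₀ ℕ) : 0 ≤ (T.tpoly v).coeff m := by
  rw [tpoly_eq, coeff_sum]
  refine Finset.sum_nonneg fun l _ => ?_
  rw [coeff_monomial]
  split_ifs <;> simp

lemma coeff_tpoly_segSum_pos {v l : T.V} (hl : T.IsLeaf l) (h : T.Desc v l) :
    0 < (T.tpoly v).coeff (T.segSum (fun c => Finsupp.single (T.label c) 1) v l) := by
  rw [tpoly_eq, coeff_sum]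
  refine Finset.sum_pos' (fun l _ => ?_) ⟨l, by simpa using ⟨hl, h⟩, ?_⟩
  · rw [coeff_monomial]
    split_ifs <;> simp
  · rw [coeff_monomial, if_pos rfl]
    exact one_pos

lemma exists_leaf_of_mem_support_tpoly {v : T.V} {m : Θ →₀ ℕ} (hm : m ∈ (T.tpoly v).support) :
    ∃ l : T.Leaf, T.Desc v l.1 ∧ T.segSum (fun c => Finsupp.single (T.label c) 1) v l.1 = m := by
  rw [tpoly_eq] at hm
  obtain ⟨l, hl, hlm⟩ := Finset.mem_biUnion.1 (support_sum hm)
  obtain ⟨hleaf, hdesc⟩ := (Finset.mem_filter.1 hl).2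
  exact ⟨⟨l, hleaf⟩, hdesc, (Finset.mem_singleton.1 (support_monomial_subset hlm)).symm⟩

/-- In a balanced tree, the labels of two paths through vertices of the same stage can be
redistributed so that the two paths exchange their edges at these vertices. -/
lemma Balanced.exists_exchange (hbal : T.Balanced) {u v ui uj vi vj : T.V}
    (huv : T.SameStage u v) (hui : T.IsChild u ui) (huj : T.IsChild u uj)
    (hvi : T.IsChild v vi) (hvj : T.IsChild v vj) (hi : T.label ui = T.label vi)
    (hj : T.label uj = T.label vj) {p q : T.Leaf} (hp : T.Desc uj p.1) (hq : T.Desc vi q.1) :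
    ∃ p' q' : T.Leaf, T.Desc ui p'.1 ∧ T.Desc vj q'.1 ∧
      T.pathSum (fun c => Finsupp.single (T.label c) 1) p'.1 +
        T.pathSum (fun c => Finsupp.single (T.label c) 1) q'.1 =
      T.pathSum (fun c => Finsupp.single (T.label c) 1) p.1 +
        T.pathSum (fun c => Finsupp.single (T.label c) (1 : ℕ)) q.1 := by
  set φ : T.V → Θ →₀ ℕ := fun c => Finsupp.single (T.label c) 1 with hφ
  have hmem : T.segSum φ uj p.1 + T.segSum φ vi q.1 ∈ (T.tpoly ui * T.tpoly vj).support := by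
    rw [hbal u v ui uj vi vj huv hui huj hvi hvj hi hj, mem_support_iff, coeff_mul]
    refine (lt_of_lt_of_le (mul_pos (coeff_tpoly_segSum_pos p.2 hp)
      (coeff_tpoly_segSum_pos q.2 hq)) ?_).ne'
    exact Finset.single_le_sum (f := fun x : (Θ →₀ ℕ) × (Θ →₀ ℕ) =>
      (T.tpoly uj).coeff x.1 * (T.tpoly vi).coeff x.2)
      (fun x _ => mul_nonneg (coeff_tpoly_nonneg _ _) (coeff_tpoly_nonneg _ _))
      (a := (T.segSum φ uj p.1, T.segSum φ vi q.1)) (Finset.HasAntidiagonal.mem_antidiagonal.2 rfl)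
  obtain ⟨m, hm, m', hm', hadd⟩ := Finset.mem_add.1 (support_mul _ _ hmem)
  obtain ⟨p', hp', rfl⟩ := exists_leaf_of_mem_support_tpoly hm
  obtain ⟨q', hq', rfl⟩ := exists_leaf_of_mem_support_tpoly hm'
  refine ⟨p', q', hp', hq', ?_⟩
  have hui' : φ ui = φ vi := by simp only [hφ, hi]
  have huj' : φ uj = φ vj := by simp only [hφ, hj]
  rw [pathSum_eq_segSum_add φ hp', pathSum_eq_segSum_add φ hq', pathSum_eq_segSum_add φ hp,
    pathSum_eq_segSum_add φ hq, hui.pathSum_eq, huj.pathSum_eq, hvi.pathSum_eq, hvj.pathSum_eq,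
    hui', huj']
  calc _ = (T.segSum φ ui p'.1 + T.segSum φ vj q'.1) +
        (φ vi + φ vj + T.pathSum φ u + T.pathSum φ v) := by abel
    _ = _ := by rw [hadd]; abel

lemma exists_leaf_label_count : ∃ (ℓ : Θ → ℕ) (K : ℕ), 2 ≤ K ∧
    Set.InjOn ℓ (Set.range T.label) ∧ ∀ v, ℓ (T.label v) < K := by
  obtain ⟨ℓ, hℓ⟩ := Set.countable_iff_exists_injOn.1 (Set.finite_range T.label).countable
  refine ⟨ℓ, Finset.univ.sup (fun v => ℓ (T.label v)) + 2, by omega, hℓ, fun v => ?_⟩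
  have := Finset.le_sup (f := fun v => ℓ (T.label v)) (Finset.mem_univ v)
  omega

/-- The vertices can be numbered in breadth-first order, compatibly with an order on the labels. -/
lemma exists_breadth_first_order (T : StagedTree Θ) : ∃ (ℓ : Θ → ℕ) (code : T.V → ℕ),
    Set.InjOn ℓ (Set.range T.label) ∧ Function.Injective code ∧
    (∀ v c, T.IsChild v c → code v < code c) ∧
    (∀ v c c', T.IsChild v c → T.IsChild v c' → ℓ (T.label c) < ℓ (T.label c') →
      code c < code c') ∧
    (∀ u v c c', T.IsChild u c → T.IsChild v c' → code u < code v → code c < code c') := by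
  obtain ⟨ℓ, K, hK, hℓ, hℓK⟩ := exists_leaf_label_count (T := T)
  let code : T.V → ℕ := fun v => K ^ T.depthOf v +
    ∑ i ∈ Finset.range (T.depthOf v), ℓ (T.label (T.parent^[i] v)) * K ^ i
  have hroot : code T.root = 1 := by simp [code, depthOf_root]
  have hchild (v c) (h : T.IsChild v c) : code c = code v * K + ℓ (T.label c) := by
    simp only [code]
    rw [h.depthOf_eq, Finset.sum_range_succ']
    simp only [Function.iterate_succ_apply, h.2, Function.iterate_zero_apply, pow_succ, pow_zero,
      mul_one, add_mul, Finset.sum_mul, mul_assoc, add_assoc]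
  have hpos (v) : 0 < code v := by
    have : 0 < K ^ T.depthOf v := pow_pos (by omega) _
    simp only [code]
    omega
  have hlt (v c) (h : T.IsChild v c) : code v < code c := by
    rw [hchild v c h]
    nlinarith [hpos v]
  have hlevel (u v c c') (h : T.IsChild u c) (h' : T.IsChild v c') (huv : code u < code v) :
      code c < code c' := by
    rw [hchild u c h, hchild v c' h']
    have := hℓK c
    nlinarith
  refine ⟨ℓ, code, hℓ, ?_, hlt, fun v c c' h h' hc => ?_, hlevel⟩
  · have hinj (n : ℕ) (v w : T.V) (hn : code v = n) (h : code v = code w) : v = w := by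
      induction n using Nat.strong_induction_on generalizing v w with
      | _ n ih =>
      by_cases hv : v = T.root
      · by_contra hne
        have hw : w ≠ T.root := fun hw => hne (hv.trans hw.symm)
        have := hlt _ w ⟨hw, rfl⟩
        have := hpos (T.parent w)
        rw [hv, hroot] at h
        omega
      by_cases hw : w = T.root
      · have := hlt _ v ⟨hv, rfl⟩
        have := hpos (T.parent v)
        rw [hw, hroot] at h
        omega
      have hpar : code (T.parent v) = code (T.parent w) := by
        rcases lt_trichotomy (code (T.parent v)) (code (T.parent w)) with h1 | h1 | h1
        · exact absurd h (hlevel _ _ _ _ ⟨hv, rfl⟩ ⟨hw, rfl⟩ h1).ne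
        · exact h1
        · exact absurd h (hlevel _ _ _ _ ⟨hw, rfl⟩ ⟨hv, rfl⟩ h1).ne'
      have hpar' := ih _ (hn ▸ hlt _ v ⟨hv, rfl⟩) _ _ rfl hpar
      refine T.label_inj v w hv hw hpar' (hℓ ⟨v, rfl⟩ ⟨w, rfl⟩ ?_)
      rw [hchild _ v ⟨hv, rfl⟩, hchild _ w ⟨hw, rfl⟩, hpar] at h
      omega
    exact fun v w h => hinj _ v w rfl h
  · rw [hchild v c h, hchild v c' h']
    omega

/-- If `W` at least halves along every edge, its sum below `c` is at most `W c`. -/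
lemma segSum_le {W : T.V → ℝ} (hW0 : ∀ v, 0 ≤ W v)
    (hW : ∀ v c, T.IsChild v c → 2 * W c ≤ W v) {c l : T.V} (h : T.Desc c l) :
    T.segSum W c l ≤ W c := by
  obtain ⟨hle, hc⟩ := desc_iff.1 h
  have key (k : ℕ) (hk : k ≤ T.depthOf l) :
      ∑ i ∈ Finset.range k, W (T.parent^[i] l) ≤ W (T.parent^[k] l) := by
    induction k with
    | zero => simpa using hW0 _
    | succ k ih =>
      rw [Finset.sum_range_succ]
      have h1 := ih (by omega)
      have h2 := hW (T.parent^[k + 1] l) (T.parent^[k] l)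
        ⟨parent_iterate_ne_root (by omega), (Function.iterate_succ_apply' T.parent k l).symm⟩
      linarith
  have := key _ (Nat.sub_le (T.depthOf l) (T.depthOf c))
  rwa [hc] at this

lemma segSum_nonneg {W : T.V → ℝ} (hW0 : ∀ v, 0 ≤ W v) (c l : T.V) : 0 ≤ T.segSum W c l :=
  Finset.sum_nonneg fun _ _ => hW0 _

/-- A weight decreasing fast in a breadth-first order strictly increases when two paths exchange
their edges so as to move the smaller label to the smaller vertex. -/
lemma pathSum_add_lt_of_exchange {W : T.V → ℝ} (hW0 : ∀ v, 0 < W v)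
    (hW : ∀ v c, T.IsChild v c → 8 * W c ≤ W v) {u v ui uj vi vj p q p' q' : T.V}
    (hui : T.IsChild u ui) (huj : T.IsChild u uj)
    (hvi : T.IsChild v vi) (hvj : T.IsChild v vj)
    (hj : 8 * W uj ≤ W ui) (hi : 8 * W vi ≤ W ui)
    (hp : T.Desc uj p) (hq : T.Desc vi q) (hp' : T.Desc ui p') (hq' : T.Desc vj q') :
    T.pathSum W p + T.pathSum W q < T.pathSum W p' + T.pathSum W q' := by
  have hW2 (v c) (h : T.IsChild v c) : 2 * W c ≤ W v := by linarith [hW v c h, hW0 c]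
  have h0 := fun v => (hW0 v).le
  rw [pathSum_eq_segSum_add W hp', pathSum_eq_segSum_add W hq', pathSum_eq_segSum_add W hp,
    pathSum_eq_segSum_add W hq, hui.pathSum_eq, huj.pathSum_eq, hvi.pathSum_eq, hvj.pathSum_eq]
  linarith [segSum_le h0 hW2 hp, segSum_le h0 hW2 hq, segSum_nonneg h0 ui p',
    segSum_nonneg h0 vj q', hW0 ui, hW0 vj]

end Exchange

section Flows

variable {T}

variable (T) in
/-- The flow through the vertex `v` of a weighting of the leaves. -/
def flow (w : T.Leaf → ℝ) (v : T.V) : ℝ := ∑ l : T.Leaf, if T.Desc v l.1 then w l else 0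

lemma flow_root (w : T.Leaf → ℝ) : T.flow w T.root = ∑ l, w l :=
  Finset.sum_congr rfl fun l _ => if_pos (desc_root l.1)

lemma flow_leaf (w : T.Leaf → ℝ) (l : T.Leaf) : T.flow w l.1 = w l := by
  rw [flow, Finset.sum_eq_single_of_mem l (Finset.mem_univ _), if_pos ⟨0, rfl⟩]
  exact fun l' _ hne => if_neg fun h => hne (Subtype.ext (h.eq_of_isLeaf l.2).symm)

lemma flow_nonneg {w : T.Leaf → ℝ} (hw : ∀ l, 0 ≤ w l) (v : T.V) : 0 ≤ T.flow w v :=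
  Finset.sum_nonneg fun l _ => by split_ifs <;> simp [hw]

lemma exists_leaf_of_flow_pos {w : T.Leaf → ℝ} {v : T.V} (h : 0 < T.flow w v) :
    ∃ l : T.Leaf, T.Desc v l.1 ∧ 0 < w l := by
  by_contra! hcon
  refine h.not_ge (Finset.sum_nonpos fun l _ => ?_)
  split_ifs with hl
  · exact hcon l hl
  · exact le_rfl

lemma sum_flow_isChild (w : T.Leaf → ℝ) {u : T.V} (hu : ¬ T.IsLeaf u) :
    ∑ c with T.IsChild u c, T.flow w c = T.flow w u := by
  simp only [flow]
  rw [Finset.sum_comm]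
  exact Finset.sum_congr rfl fun l _ => sum_isChild_ite_desc hu l (w l)

lemma sum_flow_label (w : T.Leaf → ℝ) (θ : Θ) :
    ∑ c with c ≠ T.root ∧ T.label c = θ, T.flow w c =
      ∑ l, w l * (T.pathSum (fun c => Finsupp.single (T.label c) (1 : ℕ)) l.1 θ : ℕ) := by
  simp only [flow]
  rw [Finset.sum_comm]
  refine Finset.sum_congr rfl fun l _ => ?_
  rw [pathSum_eq_sum_desc, Finsupp.finsetSum_apply, Nat.cast_sum, Finset.mul_sum,
    Finset.sum_filter, Finset.sum_filter]
  refine Finset.sum_congr rfl fun c _ => ?_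
  rw [Finsupp.single_apply]
  split_ifs <;> simp_all

/-- The leaf weightings of total mass `n` with prescribed label counts `x`. -/
def flowPolytope (T : StagedTree Θ) (n : ℝ) (x : Θ → ℝ) : Set (T.Leaf → ℝ) :=
  {w | (∀ l, 0 ≤ w l) ∧ ∑ l, w l = n ∧
    ∀ θ, ∑ l, w l * (T.pathSum (fun c => Finsupp.single (T.label c) (1 : ℕ)) l.1 θ : ℕ) = x θ}

lemma isCompact_flowPolytope (n : ℝ) (x : Θ → ℝ) : IsCompact (T.flowPolytope n x) := by
  refine (isCompact_Icc (a := (0 : T.Leaf → ℝ)) (b := fun _ => n)).of_isClosed_subset ?_ ?_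
  · simp only [flowPolytope, Set.ofPred_and, Set.ofPred_forall]
    refine (isClosed_iInter fun l => isClosed_le (by fun_prop) (by fun_prop)).inter
      ((isClosed_eq (by fun_prop) (by fun_prop)).inter
        (isClosed_iInter fun θ => isClosed_eq (by fun_prop) (by fun_prop)))
  · rintro w ⟨hw, hn, -⟩
    refine ⟨hw, fun l => ?_⟩
    rw [← hn]
    exact Finset.single_le_sum (fun l _ => hw l) (Finset.mem_univ l)

/-- Moving mass `ε` from the leaves `p`, `q` to the leaves `p'`, `q'`. -/
def shift (w : T.Leaf → ℝ) (ε : ℝ) (p q p' q' : T.Leaf) : T.Leaf → ℝ :=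
  w + ε • (Pi.single p' 1 + Pi.single q' 1 - Pi.single p 1 - Pi.single q 1)

lemma sum_shift_mul (w : T.Leaf → ℝ) (ε : ℝ) (p q p' q' : T.Leaf) (f : T.Leaf → ℝ) :
    ∑ l, shift w ε p q p' q' l * f l =
      ∑ l, w l * f l + ε * (f p' + f q' - f p - f q) := by
  have hs (r : T.Leaf) : ∑ l, (Pi.single r 1 : T.Leaf → ℝ) l * f l = f r := by
    simp [Pi.single_apply]
  rw [← hs p, ← hs q, ← hs p', ← hs q', ← Finset.sum_add_distrib, ← Finset.sum_sub_distrib,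
    ← Finset.sum_sub_distrib, Finset.mul_sum, ← Finset.sum_add_distrib]
  refine Finset.sum_congr rfl fun l _ => ?_
  simp only [shift, Pi.add_apply, Pi.smul_apply, Pi.sub_apply, smul_eq_mul]
  ring

lemma shift_nonneg {w : T.Leaf → ℝ} (hw : ∀ l, 0 ≤ w l) {ε : ℝ} (hε : 0 ≤ ε)
    {p q : T.Leaf} (hp : 2 * ε ≤ w p) (hq : 2 * ε ≤ w q) (p' q' l : T.Leaf) :
    0 ≤ shift w ε p q p' q' l := by
  have h0 (r : T.Leaf) : 0 ≤ (Pi.single r 1 : T.Leaf → ℝ) l := by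
    rw [Pi.single_apply]; split_ifs <;> simp
  have h1 := mul_nonneg hε (h0 p')
  have h2 := mul_nonneg hε (h0 q')
  have h3 : 0 ≤ w l - ε * (Pi.single p 1 : T.Leaf → ℝ) l - ε * (Pi.single q 1 : T.Leaf → ℝ) l := by
    have := hw l
    rw [Pi.single_apply, Pi.single_apply]
    split_ifs with hlp hlq hlq
    · subst hlp; linarith
    · subst hlp; linarith
    · subst hlq; linarith
    · linarith
  simp only [shift, Pi.add_apply, Pi.smul_apply, Pi.sub_apply, smul_eq_mul]
  linarith

lemma SameStage.symm {u v : T.V} (h : T.SameStage u v) : T.SameStage v u :=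
  ⟨h.2.1, h.1, fun θ => (h.2.2 θ).symm⟩

lemma SameStage.trans {u v w : T.V} (h : T.SameStage u v) (h' : T.SameStage v w) :
    T.SameStage u w :=
  ⟨h.1, h'.2.1, fun θ => (h.2.2 θ).trans (h'.2.2 θ)⟩

lemma sameStage_parent_of_label_eq {c c' : T.V} (hc : c ≠ T.root) (hc' : c' ≠ T.root)
    (h : T.label c = T.label c') : T.SameStage (T.parent c) (T.parent c') := by
  refine ⟨fun hl => hl c ⟨hc, rfl⟩, fun hl => hl c' ⟨hc', rfl⟩, fun θ => ?_⟩
  rcases T.stage_disjoint (T.parent c) (T.parent c') with hs | hs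
  · simpa only [IsChild, and_assoc] using hs θ
  · exact absurd ⟨⟨c, hc, rfl, rfl⟩, ⟨c', hc', rfl, h.symm⟩⟩ (hs (T.label c))

/-- In a balanced tree, a leaf weighting maximising a fast decreasing weight distributes the flow
through each stage in a staircase. -/
lemma label_le_of_isMaxOn (hbal : T.Balanced) {n : ℝ} {x : Θ → ℝ} {w : T.Leaf → ℝ}
    (hw : w ∈ T.flowPolytope n x) {ℓ : Θ → ℕ} {code : T.V → ℕ}
    (hchild : ∀ v c, T.IsChild v c → code v < code c)
    (hlt : ∀ v c c', T.IsChild v c → T.IsChild v c' → ℓ (T.label c) < ℓ (T.label c') →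
      code c < code c')
    (hlevel : ∀ u v c c', T.IsChild u c → T.IsChild v c' → code u < code v → code c < code c')
    (hmax : IsMaxOn (fun w : T.Leaf → ℝ =>
      ∑ l, w l * T.pathSum (fun v => (1 / 8 : ℝ) ^ code v) l.1) (T.flowPolytope n x) w)
    {c c' : T.V} (hc : c ≠ T.root) (hc' : c' ≠ T.root)
    (hs : T.SameStage (T.parent c) (T.parent c')) (hpos : 0 < T.flow w c)
    (hpos' : 0 < T.flow w c') (hcode : code (T.parent c) < code (T.parent c')) :
    ℓ (T.label c) ≤ ℓ (T.label c') := by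
  by_contra! hℓ
  obtain ⟨ui, hui, hi⟩ := (hs.2.2 (T.label c')).2 ⟨c', ⟨hc', rfl⟩, rfl⟩
  obtain ⟨vj, hvj, hj⟩ := (hs.2.2 (T.label c)).1 ⟨c, ⟨hc, rfl⟩, rfl⟩
  obtain ⟨p, hp, hwp⟩ := exists_leaf_of_flow_pos hpos
  obtain ⟨q, hq, hwq⟩ := exists_leaf_of_flow_pos hpos'
  obtain ⟨p', q', hp', hq', hsum⟩ := hbal.exists_exchange hs hui ⟨hc, rfl⟩ ⟨hc', rfl⟩ hvj
    hi hj.symm hp hq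
  have hW (a b : T.V) (hab : code a < code b) :
      8 * (1 / 8 : ℝ) ^ code b ≤ (1 / 8 : ℝ) ^ code a := by
    have h : (1 / 8 : ℝ) ^ code b ≤ (1 / 8 : ℝ) ^ (code a + 1) :=
      pow_le_pow_of_le_one (by norm_num) (by norm_num) hab
    rw [pow_succ] at h
    linarith
  have hincr := pathSum_add_lt_of_exchange (W := fun v => (1 / 8 : ℝ) ^ code v)
    (fun v => by positivity) (fun v c h => hW v c (hchild v c h)) hui ⟨hc, rfl⟩ ⟨hc', rfl⟩ hvj
    (hW _ _ (hlt _ _ _ hui ⟨hc, rfl⟩ (by rwa [hi])))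
    (hW _ _ (hlevel _ _ _ _ hui ⟨hc', rfl⟩ hcode)) hp hq hp' hq'
  let ε : ℝ := min (w p) (w q) / 2
  have hε : 0 < ε := half_pos (lt_min hwp hwq)
  have hεp : 2 * ε ≤ w p := by
    have := min_le_left (w p) (w q)
    simp only [ε]; linarith
  have hεq : 2 * ε ≤ w q := by
    have := min_le_right (w p) (w q)
    simp only [ε]; linarith
  have hmem : shift w ε p q p' q' ∈ T.flowPolytope n x := by
    refine ⟨fun l => shift_nonneg hw.1 hε.le hεp hεq p' q' l, ?_, fun θ => ?_⟩
    · have := sum_shift_mul w ε p q p' q' fun _ => 1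
      simp only [mul_one] at this
      rw [this, hw.2.1]
      ring
    · have hθ := congrArg (fun f : Θ →₀ ℕ => ((f θ : ℕ) : ℝ)) hsum
      simp only [Finsupp.add_apply, Nat.cast_add] at hθ
      rw [sum_shift_mul, hw.2.2 θ]
      linear_combination ε * hθ
  have hle := hmax hmem
  simp only [Set.mem_ofPred_eq] at hle
  rw [sum_shift_mul] at hle
  nlinarith

/-- If an integral vector of label counts is realised by a leaf weighting of integral total mass on
a balanced tree, then it is realised by an integral one. -/
lemma Balanced.exists_nat_of_nonempty (hbal : T.Balanced) {n : ℕ} {x : Θ → ℕ}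
    (hne : (T.flowPolytope n fun θ => (x θ : ℝ)).Nonempty) :
    ∃ m : T.Leaf → ℕ, ∑ l, m l = n ∧
      ∀ θ, ∑ l, m l * T.pathSum (fun c => Finsupp.single (T.label c) (1 : ℕ)) l.1 θ = x θ := by
  obtain ⟨ℓ, code, hℓ, hinj, hchild, hlt, hlevel⟩ := exists_breadth_first_order T
  obtain ⟨w, hw, hmax⟩ := (isCompact_flowPolytope (T := T) n fun θ => (x θ : ℝ)).exists_isMaxOn hne
    (f := fun w : T.Leaf → ℝ => ∑ l, w l * T.pathSum (fun v => (1 / 8 : ℝ) ^ code v) l.1)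
    (by fun_prop)
  have h_int (N : ℕ) : ∀ v, code v = N → T.flow w v ∈ (Int.castAddHom ℝ).range := by
    induction N using Nat.strong_induction_on with
    | _ N ih =>
    intro v hv
    by_cases hroot : v = T.root
    · rw [hroot, flow_root, hw.2.1]
      exact ⟨n, by simp⟩
    have hleaf : ¬ T.IsLeaf (T.parent v) := fun h => h v ⟨hroot, rfl⟩
    let E : Finset T.V := {c | c ≠ T.root ∧ T.SameStage (T.parent v) (T.parent c)}
    have hE (c) : c ∈ E ↔ c ≠ T.root ∧ T.SameStage (T.parent v) (T.parent c) := by simp [E]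
    refine mem_int_range_of_staircase E (fun c => code (T.parent c)) (fun c => ℓ (T.label c))
      (T.flow w) (fun c _ => flow_nonneg hw.1 c) ?_ ?_ ?_ ((hE v).2 ⟨hroot, hleaf, hleaf,
        fun _ => Iff.rfl⟩) ?_
    · intro c hc c' hc' hr hs
      exact T.label_inj c c' ((hE c).1 hc).1 ((hE c').1 hc').1 (hinj hr) (hℓ ⟨c, rfl⟩ ⟨c', rfl⟩ hs)
    · intro c hc c' hc' hpos hpos' hr
      rw [hE] at hc hc'
      exact label_le_of_isMaxOn hbal hw hchild hlt hlevel hmax hc.1 hc'.1 (hc.2.symm.trans hc'.2)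
        hpos hpos' hr
    · intro b
      rcases Finset.eq_empty_or_nonempty (E.filter fun c => ℓ (T.label c) = b) with he | ⟨c₀, hc₀⟩
      · rw [he, Finset.sum_empty]
        exact zero_mem _
      · rw [Finset.mem_filter, hE] at hc₀
        obtain ⟨⟨hc₀root, hc₀stage⟩, rfl⟩ := hc₀
        have : E.filter (fun c => ℓ (T.label c) = ℓ (T.label c₀)) =
            Finset.univ.filter fun c => c ≠ T.root ∧ T.label c = T.label c₀ := by
          ext c
          rw [Finset.mem_filter, hE, Finset.mem_filter]
          constructor
          · exact fun h => ⟨Finset.mem_univ _, h.1.1, hℓ ⟨c, rfl⟩ ⟨c₀, rfl⟩ h.2⟩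
          · exact fun h => ⟨⟨h.2.1, hc₀stage.trans
              (sameStage_parent_of_label_eq hc₀root h.2.1 h.2.2.symm)⟩, congrArg ℓ h.2.2⟩
        rw [this, sum_flow_label, hw.2.2]
        exact ⟨x (T.label c₀), by simp⟩
    · intro a ha
      rcases Finset.eq_empty_or_nonempty (E.filter fun c => code (T.parent c) = a) with
        he | ⟨c₀, hc₀⟩
      · rw [he, Finset.sum_empty]
        exact zero_mem _
      · rw [Finset.mem_filter, hE] at hc₀
        obtain ⟨⟨hc₀root, hc₀stage⟩, rfl⟩ := hc₀
        have : E.filter (fun c => code (T.parent c) = code (T.parent c₀)) =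
            Finset.univ.filter fun c => T.IsChild (T.parent c₀) c := by
          ext c
          rw [Finset.mem_filter, hE, Finset.mem_filter]
          constructor
          · exact fun h => ⟨Finset.mem_univ _, h.1.1, hinj h.2⟩
          · rintro ⟨-, h1, h2⟩
            exact ⟨⟨h1, h2 ▸ hc₀stage⟩, congrArg code h2⟩
        rw [this, sum_flow_isChild w hc₀stage.2.1]
        exact ih _ (hv ▸ ha.trans_lt (hchild _ v ⟨hroot, rfl⟩)) _ rfl
  have hnat (l : T.Leaf) : ∃ m : ℕ, (m : ℝ) = w l := by
    obtain ⟨k, hk⟩ := h_int _ l.1 rfl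
    rw [flow_leaf] at hk
    replace hk : (k : ℝ) = w l := hk
    have hk0 : 0 ≤ k := Int.cast_nonneg_iff.1 (hk ▸ hw.1 l)
    refine ⟨k.toNat, ?_⟩
    rw [← hk, ← Int.cast_natCast, Int.toNat_of_nonneg hk0]
  choose m hm using hnat
  refine ⟨m, ?_, fun θ => ?_⟩
  · have := hw.2.1
    simp only [← hm] at this
    exact_mod_cast this
  · have := hw.2.2 θ
    simp only [← hm] at this
    exact_mod_cast this

end Flows

section PathMonoid

variable {T}

lemma hpmExp_some (l : T.V) (θ : Θ) :
    T.hpmExp l (some θ) = T.pathSum (fun c => Finsupp.single (T.label c) (1 : ℕ)) l θ := by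
  simp [hpmExp, pathSum, Finsupp.finsetSum_apply, Finsupp.single_apply]

lemma degree_hpmExp (l : T.V) : (T.hpmExp l).degree = T.depth := by
  have := depthOf_le_depth l
  simp only [hpmExp, map_add, map_sum, Finsupp.degree_single, Finset.sum_const, Finset.card_range,
    smul_eq_mul, mul_one]
  omega

lemma hpm_eq_monomial (l : T.V) : T.hpm l = monomial (T.hpmExp l) 1 := by
  have h : (∏ i ∈ Finset.range (T.depthOf l), X (some (T.label (T.parent^[i] l))) :
      MvPolynomial (Option Θ) ℝ) = monomial
        (∑ i ∈ Finset.range (T.depthOf l), Finsupp.single (some (T.label (T.parent^[i] l))) 1) 1 := by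
    rw [monomial_sum_one]
    rfl
  rw [hpm, hpmExp, h, X_pow_eq_monomial, monomial_mul, one_mul]

lemma mem_pathMonoid_iff {a : Option Θ →₀ ℕ} :
    a ∈ T.pathMonoid ↔ ∃ m : T.Leaf → ℕ, ∑ l, m l • T.hpmExp l.1 = a := by
  rw [pathMonoid, AddSubmonoid.mem_closure_range_iff_of_fintype]
  exact exists_congr fun _ => eq_comm

lemma eq_of_degree_eq {σ : Type*} {a b : Option σ →₀ ℕ} (hdeg : a.degree = b.degree)
    (h : ∀ i, a (some i) = b (some i)) : a = b := by
  have herase : a.erase none = b.erase none := by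
    ext (_ | i)
    · simp
    · simpa using h i
  have hdeg' (f : Option σ →₀ ℕ) : f.degree = f none + (f.erase none).degree := by
    conv_lhs => rw [← Finsupp.single_add_erase none f]
    rw [map_add, Finsupp.degree_single]
  ext (_ | i)
  · rw [hdeg' a, hdeg' b, herase] at hdeg
    omega
  · exact h i

/-- The path monoid of a balanced tree is saturated in the group it generates. -/
theorem Balanced.mem_pathMonoid_of_nsmul_mem (hbal : T.Balanced) {x b : Option Θ →₀ ℕ}
    (hb : b ∈ T.pathMonoid) (hxb : x + b ∈ T.pathMonoid) {N : ℕ} (hN : 0 < N)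
    (hx : N • x ∈ T.pathMonoid) : x ∈ T.pathMonoid := by
  rw [mem_pathMonoid_iff] at hb hxb hx
  obtain ⟨mb, hmb⟩ := hb
  obtain ⟨mc, hmc⟩ := hxb
  obtain ⟨ma, hma⟩ := hx
  have hdeg (m : T.Leaf → ℕ) :
      (∑ l, m l • T.hpmExp l.1).degree = (∑ l, m l) * T.depth := by
    simp only [map_sum, map_nsmul, degree_hpmExp, smul_eq_mul, Finset.sum_mul]
  have hb := hdeg mb
  have hc := hdeg mc
  have ha := hdeg ma
  rw [hmb] at hb
  rw [hmc, map_add, hb] at hc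
  rw [hma, map_nsmul, smul_eq_mul] at ha
  rcases Nat.eq_zero_or_pos T.depth with hd | hd
  · rw [hd, mul_zero, mul_zero, add_zero] at hc
    rw [(Finsupp.degree_eq_zero_iff x).1 hc]
    exact zero_mem _
  obtain ⟨n, hn⟩ : ∃ n, x.degree = n * T.depth :=
    ⟨∑ l, mc l - ∑ l, mb l, by rw [Nat.sub_mul]; omega⟩
  have hma' : ∑ l, ma l = N * n := by
    rw [hn, ← mul_assoc] at ha
    exact (Nat.eq_of_mul_eq_mul_right hd ha).symm
  have hN' : (N : ℝ) ≠ 0 := by exact_mod_cast hN.ne'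
  have hmem : (fun l => (ma l : ℝ) / N) ∈ T.flowPolytope n fun θ => (x (some θ) : ℝ) := by
    refine ⟨fun l => by positivity, ?_, fun θ => ?_⟩
    · rw [← Finset.sum_div, div_eq_iff hN', mul_comm]
      exact_mod_cast hma'
    · have hθ := DFunLike.congr_fun hma (some θ)
      simp only [Finsupp.finsetSum_apply, Finsupp.smul_apply, hpmExp_some, smul_eq_mul] at hθ
      simp only [div_mul_eq_mul_div]
      rw [← Finset.sum_div, div_eq_iff hN', mul_comm (x (some θ) : ℝ)]
      exact_mod_cast hθ
  obtain ⟨m, hm, hmx⟩ := hbal.exists_nat_of_nonempty ⟨_, hmem⟩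
  refine mem_pathMonoid_iff.2 ⟨m, eq_of_degree_eq (by rw [hdeg, hm, hn]) fun θ => ?_⟩
  rw [← hmx θ]
  simp only [Finsupp.finsetSum_apply, Finsupp.smul_apply, hpmExp_some, smul_eq_mul]

end PathMonoid

/-- For a balanced staged tree `𝒯`, the monomial algebra `A_𝒯` is a
normal ring (integrally closed in its field of fractions); equivalently, the semigroup `M`
of monomials generated by the path monomials is normal: whenever `a, b, c ∈ M` satisfy
`a·b^N = c^N` (additively `a + N•b = N•c`) with `N > 0`, there is `e ∈ M` with
`a = e^N`. -/
theorem balanced_pathAlgebra_normal (hbal : T.Balanced) :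
    IsIntegrallyClosed (T.pathAlgebra) ∧
    (∀ a b c : Option Θ →₀ ℕ, a ∈ T.pathMonoid → b ∈ T.pathMonoid → c ∈ T.pathMonoid →
      ∀ N : ℕ, 0 < N → a + N • b = N • c → ∃ e ∈ T.pathMonoid, a = N • e) := by
  constructor
  · refine MvPolynomial.isIntegrallyClosed_of_normal (M := T.pathMonoid) (fun f => ?_)
      fun m b hb hmb N hN hm => hbal.mem_pathMonoid_of_nsmul_mem hb hmb hN hm
    simp only [pathAlgebra, pathMonoid, hpm_eq_monomial]
    exact mem_adjoin_monomial_iff _ f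
  · intro a b c ha hb hc N hN habc
    have hle : b ≤ c := fun i => by
      have := DFunLike.congr_fun habc i
      simp only [Finsupp.add_apply, Finsupp.smul_apply, smul_eq_mul] at this
      exact Nat.le_of_mul_le_mul_left (by omega) hN
    have hcb : c - b + b = c := tsub_add_cancel_of_le hle
    have hea : N • (c - b) = a := by
      refine add_right_cancel (b := N • b) ?_
      rw [← nsmul_add, hcb, habc]
    exact ⟨c - b, hbal.mem_pathMonoid_of_nsmul_mem hb (hcb.symm ▸ hc) hN (hea.symm ▸ ha), hea.symm⟩

end StagedTree
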